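/- arXiv:2201.01247 — 4 statements merged into one kernel-verified Lean document; each statement's English description precedes it below -/
import Mathlib

section
/- Let A, T, M be finite nonempty types and let p : A × T × M → ℝ be a strictly positive joint probability mass function (p(a,t,m) > 0 for all a,t,m and the values sum to 1). Let q : T × M → A → ℝ be any family of strictly positive conditional probability mass functions (for each (t,m), q(t,m)(a) > 0 and ∑_a q(t,m)(a) = 1). Then the conditional mutual information satisfies the variational lower bound I_p(A ; M | T) ≥ ∑_{a,t,m} p(a,t,m) · log q(t,m)(a) + H_p(A | T); that is, the conditional mutual information between A and M given T is bounded below by the expected log-likelihood of the variational decoder plus the conditional entropy of A given T. -/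
open Finset

/-- Marginal pmf of (A,T) from a joint pmf on A × T × M. -/
noncomputable def margAT {A T M : Type*} [Fintype M] (p : A × T × M → ℝ) (a : A) (t : T) : ℝ :=
  ∑ m, p (a, t, m)

/-- Marginal pmf of (T,M) from a joint pmf on A × T × M. -/
noncomputable def margTM {A T M : Type*} [Fintype A] (p : A × T × M → ℝ) (t : T) (m : M) : ℝ :=
  ∑ a, p (a, t, m)

/-- Marginal pmf of T from a joint pmf on A × T × M. -/
noncomputable def margT {A T M : Type*} [Fintype A] [Fintype M] (p : A × T × M → ℝ) (t : T) : ℝ :=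
  ∑ a, ∑ m, p (a, t, m)

/-- Conditional entropy H(A | T) = −∑_{a,t} p_{A,T}(a,t) log p(a|t). -/
noncomputable def condEntropyAT {A T M : Type*} [Fintype A] [Fintype T] [Fintype M]
    (p : A × T × M → ℝ) : ℝ :=
  -∑ a, ∑ t, margAT p a t * Real.log (margAT p a t / margT p t)

/-- Conditional mutual information
I(A ; M | T) = ∑_{a,t,m} p(a,t,m) log( p(a,m|t) / (p(a|t) p(m|t)) ). -/
noncomputable def condMI {A T M : Type*} [Fintype A] [Fintype T] [Fintype M]
    (p : A × T × M → ℝ) : ℝ :=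
  ∑ a, ∑ t, ∑ m, p (a, t, m) *
    Real.log ((p (a, t, m) / margT p t) /
      ((margAT p a t / margT p t) * (margTM p t m / margT p t)))

theorem sub_le_mul_log_div {x y : ℝ} (hx : 0 < x) (hy : 0 < y) :
    x - y ≤ x * Real.log (x / y) := by
  have h := mul_le_mul_of_nonneg_left (Real.one_sub_inv_le_log_of_pos (div_pos hx hy)) hx.le
  have e : x * (1 - (x / y)⁻¹) = x - y := by field_simp
  linarith

theorem condEntropyAT_eq_neg_sum {A T M : Type*} [Fintype A] [Fintype T] [Fintype M]
    (p : A × T × M → ℝ) :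
    condEntropyAT p =
      -∑ a, ∑ t, ∑ m, p (a, t, m) * Real.log (margAT p a t / margT p t) := by
  simp only [condEntropyAT, margAT, Finset.sum_mul]

theorem sum_margTM_mul_eq_sum {A T M : Type*} [Fintype A] [Fintype T] [Fintype M]
    (p : A × T × M → ℝ) (q : T × M → A → ℝ) (hqsum : ∀ tm, ∑ a, q tm a = 1) :
    ∑ a, ∑ t, ∑ m, margTM p t m * q (t, m) a = ∑ a, ∑ t, ∑ m, p (a, t, m) := by
  have key (f : A → T → M → ℝ) : ∑ a, ∑ t, ∑ m, f a t m = ∑ t, ∑ m, ∑ a, f a t m := by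
    rw [Finset.sum_comm]
    exact Finset.sum_congr rfl fun t _ => Finset.sum_comm
  rw [key, key]
  simp only [← Finset.mul_sum, hqsum, mul_one, margTM]

/-- Variational lower bound on conditional mutual information (Lemma 1):
I(A ; M | T) ≥ ∑_{a,t,m} p(a,t,m) log q(t,m)(a) + H(A | T). -/
theorem variational_lower_bound_condMI
    {A T M : Type*} [Fintype A] [Fintype T] [Fintype M]
    [Nonempty A] [Nonempty T] [Nonempty M]
    (p : A × T × M → ℝ) (hp : ∀ x, 0 < p x) (hpsum : ∑ x, p x = 1)
    (q : T × M → A → ℝ) (hq : ∀ tm a, 0 < q tm a) (hqsum : ∀ tm, ∑ a, q tm a = 1) :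
    condMI p ≥ (∑ a, ∑ t, ∑ m, p (a, t, m) * Real.log (q (t, m) a)) + condEntropyAT p := by
  have hAT (a : A) (t : T) : 0 < margAT p a t :=
    Finset.sum_pos (fun m _ => hp _) Finset.univ_nonempty
  have hTM (t : T) (m : M) : 0 < margTM p t m :=
    Finset.sum_pos (fun a _ => hp _) Finset.univ_nonempty
  have hT (t : T) : 0 < margT p t :=
    Finset.sum_pos (fun a _ => hAT a t) Finset.univ_nonempty
  have pointwise (a : A) (t : T) (m : M) :
      p (a, t, m) * Real.log (q (t, m) a)
        - p (a, t, m) * Real.log (margAT p a t / margT p t)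
        + (p (a, t, m) - margTM p t m * q (t, m) a) ≤
      p (a, t, m) * Real.log ((p (a, t, m) / margT p t) /
        ((margAT p a t / margT p t) * (margTM p t m / margT p t))) := by
    have hP := hp (a, t, m)
    have hQ := hq (t, m) a
    have h₁ := hAT a t
    have h₂ := hTM t m
    have h₃ := hT t
    have h := sub_le_mul_log_div hP (mul_pos h₂ hQ)
    rw [Real.log_div hP.ne' (mul_pos h₂ hQ).ne', Real.log_mul h₂.ne' hQ.ne'] at h
    rw [Real.log_div (div_pos hP h₃).ne' (mul_pos (div_pos h₁ h₃) (div_pos h₂ h₃)).ne',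
      Real.log_mul (div_pos h₁ h₃).ne' (div_pos h₂ h₃).ne', Real.log_div hP.ne' h₃.ne',
      Real.log_div h₂.ne' h₃.ne']
    linarith
  have total := Finset.sum_le_sum fun a (_ : a ∈ Finset.univ) =>
    Finset.sum_le_sum fun t (_ : t ∈ Finset.univ) =>
      Finset.sum_le_sum fun m (_ : m ∈ Finset.univ) => pointwise a t m
  simp only [Finset.sum_add_distrib, Finset.sum_sub_distrib] at total
  rw [sum_margTM_mul_eq_sum p q hqsum] at total
  rw [condEntropyAT_eq_neg_sum, condMI]
  linarith
end

section
/- Let X and Y be finite nonempty types, p : X × Y → ℝ a strictly positive joint probability mass function, and q : Y → X → ℝ a family of strictly positive conditional probability mass functions. Then the mutual information satisfies I_p(X ; Y) ≥ H_p(X) + ∑_{x,y} p(x,y) · log q(y)(x), with equality if and only if q(y) equals the conditional pmf p(X|y) for every y. -/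
open Finset

/-- Marginal pmf of X from a joint pmf on X × Y. -/
noncomputable def margX {X Y : Type*} [Fintype Y] (p : X × Y → ℝ) (x : X) : ℝ :=
  ∑ y, p (x, y)

/-- Marginal pmf of Y from a joint pmf on X × Y. -/
noncomputable def margY {X Y : Type*} [Fintype X] (p : X × Y → ℝ) (y : Y) : ℝ :=
  ∑ x, p (x, y)

/-- Entropy H(X) = −∑_x p_X(x) log p_X(x). -/
noncomputable def entropyX {X Y : Type*} [Fintype X] [Fintype Y] (p : X × Y → ℝ) : ℝ :=
  -∑ x, margX p x * Real.log (margX p x)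

/-- Mutual information I(X;Y) = ∑_{x,y} p(x,y) log( p(x,y) / (p_X(x) p_Y(y)) ). -/
noncomputable def mutualInfo {X Y : Type*} [Fintype X] [Fintype Y] (p : X × Y → ℝ) : ℝ :=
  ∑ x, ∑ y, p (x, y) * Real.log (p (x, y) / (margX p x * margY p y))

lemma margX_pos {X Y : Type*} [Fintype Y] [Nonempty Y] {p : X × Y → ℝ} (hp : ∀ z, 0 < p z)
    (x : X) : 0 < margX p x :=
  Finset.sum_pos (fun _ _ => hp _) Finset.univ_nonempty

lemma margY_pos {X Y : Type*} [Fintype X] [Nonempty X] {p : X × Y → ℝ} (hp : ∀ z, 0 < p z)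
    (y : Y) : 0 < margY p y :=
  Finset.sum_pos (fun _ _ => hp _) Finset.univ_nonempty

lemma sub_le_mul_log_sub_log {a b : ℝ} (ha : 0 < a) (hb : 0 < b) :
    a - b ≤ a * (Real.log a - Real.log b) := by
  have h := Real.log_le_sub_one_of_pos (div_pos hb ha)
  rw [Real.log_div hb.ne' ha.ne'] at h
  have h2 := mul_le_mul_of_nonneg_left h ha.le
  rw [mul_sub a (b / a) 1, mul_div_cancel₀ _ ha.ne'] at h2
  linarith

lemma sub_eq_mul_log_sub_log_iff {a b : ℝ} (ha : 0 < a) (hb : 0 < b) :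
    a - b = a * (Real.log a - Real.log b) ↔ a = b := by
  refine ⟨fun heq => ?_, fun h => by simp [h]⟩
  by_contra hne
  have h := Real.log_lt_sub_one_of_pos (div_pos hb ha)
    (fun h => hne ((div_eq_one_iff_eq ha.ne').1 h).symm)
  rw [Real.log_div hb.ne' ha.ne'] at h
  have h2 := mul_lt_mul_of_pos_left h ha
  rw [mul_sub a (b / a) 1, mul_div_cancel₀ _ ha.ne'] at h2
  linarith

/-- The gap in the variational bound is the relative entropy of `p` from `q(x|y) p_Y(y)`,
written as a sum of pointwise nonnegative terms. -/
lemma mutualInfo_sub_variational_eq_sum {X Y : Type*} [Fintype X] [Fintype Y] [Nonempty X]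
    [Nonempty Y] (p : X × Y → ℝ) (hp : ∀ z, 0 < p z)
    (q : Y → X → ℝ) (hq : ∀ y x, 0 < q y x) (hqsum : ∀ y, ∑ x, q y x = 1) :
    mutualInfo p - (entropyX p + ∑ x, ∑ y, p (x, y) * Real.log (q y x)) =
      ∑ z : X × Y, (p z * (Real.log (p z) - Real.log (q z.2 z.1 * margY p z.2)) -
        (p z - q z.2 z.1 * margY p z.2)) := by
  have hb : ∑ z : X × Y, q z.2 z.1 * margY p z.2 = ∑ z, p z := by
    rw [Fintype.sum_prod_type_right, Fintype.sum_prod_type_right]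
    refine Finset.sum_congr rfl fun y _ => ?_
    simp only [← Finset.sum_mul, hqsum, one_mul, margY]
  have hH : entropyX p = -∑ x, ∑ y, p (x, y) * Real.log (margX p x) := by
    simp only [entropyX, ← Finset.sum_mul, margX]
  rw [Finset.sum_sub_distrib, Finset.sum_sub_distrib, hb, sub_self, sub_zero, hH, mutualInfo,
    Fintype.sum_prod_type, ← Finset.sum_neg_distrib, ← Finset.sum_add_distrib,
    ← Finset.sum_sub_distrib]
  refine Finset.sum_congr rfl fun x _ => ?_
  rw [← Finset.sum_neg_distrib, ← Finset.sum_add_distrib, ← Finset.sum_sub_distrib]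
  refine Finset.sum_congr rfl fun y _ => ?_
  have hX := margX_pos hp x
  have hY := margY_pos hp y
  rw [Real.log_div (hp _).ne' (mul_pos hX hY).ne', Real.log_mul hX.ne' hY.ne',
    Real.log_mul (hq y x).ne' hY.ne']
  ring

/-- Unconditional variational lower bound on mutual information:
I(X;Y) ≥ H(X) + ∑_{x,y} p(x,y) log q(y)(x), with equality iff
q(y) is the true conditional p(X | y) for every y. -/
theorem variational_lower_bound_MI
    {X Y : Type*} [Fintype X] [Fintype Y] [Nonempty X] [Nonempty Y]
    (p : X × Y → ℝ) (hp : ∀ z, 0 < p z) (hpsum : ∑ z, p z = 1)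
    (q : Y → X → ℝ) (hq : ∀ y x, 0 < q y x) (hqsum : ∀ y, ∑ x, q y x = 1) :
    mutualInfo p ≥ entropyX p + ∑ x, ∑ y, p (x, y) * Real.log (q y x) ∧
    (mutualInfo p = entropyX p + ∑ x, ∑ y, p (x, y) * Real.log (q y x)
      ↔ ∀ y, q y = fun x => p (x, y) / margY p y) := by
  have hgap := mutualInfo_sub_variational_eq_sum p hp q hq hqsum
  have hpos (z : X × Y) : 0 < q z.2 z.1 * margY p z.2 := mul_pos (hq _ _) (margY_pos hp _)
  have hterm (z : X × Y) := sub_nonneg.2 (sub_le_mul_log_sub_log (hp z) (hpos z))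
  refine ⟨sub_nonneg.1 (hgap ▸ Finset.sum_nonneg fun z _ => hterm z), ?_⟩
  rw [← sub_eq_zero, hgap, Finset.sum_eq_zero_iff_of_nonneg fun z _ => hterm z]
  simp only [Finset.mem_univ, true_imp_iff, sub_eq_zero, funext_iff]
  have hiff (x : X) (y : Y) : p (x, y) * (Real.log (p (x, y)) - Real.log (q y x * margY p y)) =
      p (x, y) - q y x * margY p y ↔ q y x = p (x, y) / margY p y := by
    rw [eq_comm, sub_eq_mul_log_sub_log_iff (hp _) (hpos (x, y)),
      eq_div_iff (margY_pos hp y).ne', eq_comm]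
  exact ⟨fun h y x => (hiff x y).1 (h (x, y)), fun h z => (hiff z.1 z.2).2 (h z.2 z.1)⟩
end

section
/- Let n be a positive natural number, let U₁, …, Uₙ be finite nonempty types of actions, and for each i let qᵢ : Uᵢ → ℝ be a local utility function. Let f : ℝⁿ → ℝ be strictly increasing in each coordinate (for every index i, fixing the other coordinates, f is a strictly monotone increasing function of the i-th coordinate). Define Q_tot(u₁,…,uₙ) = f(q₁(u₁), …, qₙ(uₙ)). Then a joint action (u₁,…,uₙ) maximizes Q_tot over U₁ × ⋯ × Uₙ if and only if for every i, uᵢ maximizes qᵢ over Uᵢ. In particular, the global argmax of Q_tot coincides with the tuple of individual argmax operations (the Individual-Global-Max property). -/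
open Finset

/-- A function on a finite product that is monotone in each coordinate is monotone. -/
theorem monotone_of_forall_monotone_update {ι β : Type*} {α : ι → Type*} [Finite ι]
    [DecidableEq ι] [∀ i, Preorder (α i)] [Preorder β] {f : (∀ i, α i) → β}
    (hf : ∀ i x, Monotone fun a => f (Function.update x i a)) : Monotone f := by
  have := Fintype.ofFinite ι
  intro x y hxy
  have key (s : Finset ι) : f x ≤ f (s.piecewise y x) := by
    induction s using Finset.induction_on with
    | empty => simp
    | insert j s hj ih =>
      rw [Finset.piecewise_insert]
      refine ih.trans ?_
      have hle : s.piecewise y x j ≤ y j := by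
        rw [Finset.piecewise_eq_of_notMem _ _ _ hj]
        exact hxy j
      simpa using hf j (s.piecewise y x) hle
  simpa using key Finset.univ

/-- Individual-Global-Max (IGM) property for a mixing function that is strictly
increasing in each coordinate: a joint action maximizes
Q_tot(u) = f(q₁(u₁), …, qₙ(uₙ)) iff each uᵢ maximizes qᵢ. -/
theorem igm_of_strictly_monotone_mixing
    (n : ℕ) (hn : 0 < n) (U : Fin n → Type*)
    [∀ i, Fintype (U i)] [∀ i, Nonempty (U i)]
    (q : ∀ i, U i → ℝ)
    (f : (Fin n → ℝ) → ℝ)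
    (hf : ∀ (i : Fin n) (x : Fin n → ℝ) (a b : ℝ), a < b →
      f (Function.update x i a) < f (Function.update x i b))
    (u : ∀ i, U i) :
    (∀ v : ∀ i, U i, f (fun i => q i (v i)) ≤ f (fun i => q i (u i)))
      ↔ ∀ (i : Fin n) (w : U i), q i w ≤ q i (u i) := by
  refine ⟨fun h i w => ?_, fun h v => ?_⟩
  · by_contra! hlt
    have hupd : (fun j => q j (Function.update u i w j)) =
        Function.update (fun j => q j (u j)) i (q i w) :=
      funext fun j => Function.apply_update (fun j => q j) u i w j
    have hle := h (Function.update u i w)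
    rw [hupd] at hle
    have hstrict := hf i (fun j => q j (u j)) _ _ hlt
    rw [Function.update_eq_self] at hstrict
    exact hstrict.not_ge hle
  · have hmono : Monotone f :=
      monotone_of_forall_monotone_update fun i x => StrictMono.monotone fun a b => hf i x a b
    exact hmono fun i => h i (v i)
end

section
/- Let P : Fin 3 × Fin 3 → ℝ be the payoff matrix of the single-state matrix game with P(A,A) = 8, P(A,B) = P(A,C) = P(B,A) = P(C,A) = −12, and P(u₁,u₂) = 0 for u₁,u₂ ∈ {B,C} (identifying A,B,C with 0,1,2 in Fin 3). Then there do not exist functions q₁, q₂ : Fin 3 → ℝ and a mixing function f : ℝ × ℝ → ℝ that is monotonically nondecreasing in each argument such that f(q₁(u₁), q₂(u₂)) = P(u₁,u₂) for all u₁, u₂. That is, this payoff matrix cannot be exactly represented by any monotonic value function factorization of QMIX type. -/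
open Finset

/-- Payoff matrix of the single-state matrix game of Table 1(a):
both play A ↦ 8, exactly one plays A ↦ −12, otherwise 0
(actions A, B, C identified with 0, 1, 2 : Fin 3). -/
noncomputable def payoff : Fin 3 × Fin 3 → ℝ :=
  fun u => !![(8 : ℝ), -12, -12; -12, 0, 0; -12, 0, 0] u.1 u.2

/-- The non-monotonic matrix game cannot be represented exactly by any
QMIX-type factorization Q_tot(u₁,u₂) = f(q₁(u₁), q₂(u₂)) with f
monotonically nondecreasing in each argument. -/
theorem no_monotonic_factorization :
    ¬ ∃ (q₁ q₂ : Fin 3 → ℝ) (f : ℝ × ℝ → ℝ),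
      (∀ y : ℝ, Monotone fun x : ℝ => f (x, y)) ∧
      (∀ x : ℝ, Monotone fun y : ℝ => f (x, y)) ∧
      (∀ u₁ u₂ : Fin 3, f (q₁ u₁, q₂ u₂) = payoff (u₁, u₂)) := by
  rintro ⟨q₁, q₂, f, hf, -, h⟩
  rcases le_total (q₁ 0) (q₁ 1) with hq | hq
  · have hA : f (q₁ 0, q₂ 0) ≤ f (q₁ 1, q₂ 0) := hf (q₂ 0) hq
    rw [h, h] at hA
    norm_num [payoff] at hA
  · have hB : f (q₁ 1, q₂ 1) ≤ f (q₁ 0, q₂ 1) := hf (q₂ 1) hq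
    rw [h, h] at hB
    norm_num [payoff] at hB
end
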